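/- Let a, b, θ, H > 0 and for V, E ∈ (0,1] define P(V,E) = H · V^a · E^b / (V^a · E^b + θ). Then for all V, E ∈ (0,1], the mixed second partial derivative of (s,t) ↦ ln P(exp s, exp t) evaluated at (ln V, ln E) equals −a·b·θ·V^a·E^b / (V^a·E^b + θ)², and in particular it is strictly negative. -/

import Mathlib

open Real

/-- In logarithmic coordinates the log of the Tullock contest function is an affine function
minus a softplus term. -/
lemma log_tullock_exp {H θ : ℝ} (hH : 0 < H) (hθ : 0 < θ) (a b s t : ℝ) :
    Real.log (H * (Real.exp s) ^ a * (Real.exp t) ^ b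
      / ((Real.exp s) ^ a * (Real.exp t) ^ b + θ))
    = Real.log H + (s * a + t * b) - Real.log (Real.exp (s * a + t * b) + θ) := by
  have hpos : 0 < Real.exp (s * a + t * b) + θ := by positivity
  rw [mul_assoc, ← Real.exp_mul, ← Real.exp_mul, ← Real.exp_add,
    Real.log_div (by positivity) hpos.ne', Real.log_mul hH.ne' (Real.exp_pos _).ne',
    Real.log_exp]

lemma hasDerivAt_log_tullock_exp {H θ : ℝ} (hH : 0 < H) (hθ : 0 < θ) (a b s t : ℝ) :
    HasDerivAt (fun s : ℝ => Real.log (H * (Real.exp s) ^ a * (Real.exp t) ^ b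
      / ((Real.exp s) ^ a * (Real.exp t) ^ b + θ)))
      (a * θ / (Real.exp (s * a + t * b) + θ)) s := by
  have hpos : 0 < Real.exp (s * a + t * b) + θ := by positivity
  simp only [log_tullock_exp hH hθ]
  have hlin : HasDerivAt (fun s : ℝ => s * a + t * b) a s := by
    simpa using ((hasDerivAt_id s).mul_const a).add_const (t * b)
  refine ((hlin.const_add (Real.log H)).sub
    ((hlin.exp.add_const θ).log hpos.ne')).congr_deriv ?_
  field_simp
  ring

/-- The log-log cross-partial: the mixed second partial derivative of
`(s,t) ↦ ln P(exp s, exp t)` at `(ln V, ln E)` equals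
`-a*b*θ*V^a*E^b/(V^a*E^b + θ)^2`, which is strictly negative. -/
theorem loglog_cross_partial
    (a b θ H : ℝ) (ha : 0 < a) (hb : 0 < b) (hθ : 0 < θ) (hH : 0 < H)
    (V E : ℝ) (hV : V ∈ Set.Ioc (0:ℝ) 1) (hE : E ∈ Set.Ioc (0:ℝ) 1) :
    HasDerivAt
      (fun t : ℝ => deriv
        (fun s : ℝ => Real.log (H * (Real.exp s) ^ a * (Real.exp t) ^ b
          / ((Real.exp s) ^ a * (Real.exp t) ^ b + θ))) (Real.log V))
      (-(a * b * θ * V ^ a * E ^ b) / (V ^ a * E ^ b + θ) ^ 2) (Real.log E) ∧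
    -(a * b * θ * V ^ a * E ^ b) / (V ^ a * E ^ b + θ) ^ 2 < 0 := by
  have hx : 0 < V ^ a * E ^ b := mul_pos (Real.rpow_pos_of_pos hV.1 a) (Real.rpow_pos_of_pos hE.1 b)
  have hexp : Real.exp (Real.log V * a + Real.log E * b) = V ^ a * E ^ b := by
    rw [Real.exp_add, Real.rpow_def_of_pos hV.1, Real.rpow_def_of_pos hE.1]
  constructor
  · simp only [(hasDerivAt_log_tullock_exp hH hθ a b _ _).deriv]
    have hlin : HasDerivAt (fun t : ℝ => Real.log V * a + t * b) b (Real.log E) := by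
      simpa using ((hasDerivAt_id (Real.log E)).mul_const b).const_add (Real.log V * a)
    have hne : Real.exp (Real.log V * a + Real.log E * b) + θ ≠ 0 := by positivity
    refine ((hasDerivAt_const _ (a * θ)).div (hlin.exp.add_const θ) hne).congr_deriv ?_
    rw [hexp]
    ring
  · refine div_neg_of_neg_of_pos (neg_lt_zero.mpr ?_) (by positivity)
    rw [mul_assoc _ (V ^ a)]
    positivity
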